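/- arXiv:math/0611529 — 2 statements merged into one kernel-verified Lean document; each statement's English description precedes it below -/
import Mathlib

section
/- Let n ≥ 2, 1 ≤ i ≤ n−1, and let σ be a permutation of {1,…,n} having the maximal number of inversions among all permutations τ with τ({1,…,i}) = σ({1,…,i}). Set S = σ({1,…,i}). Then the number of non-inversions of σ satisfies #{(j,k) : 1 ≤ j < k ≤ n, σ(j) < σ(k)} = ½( i(n−i) + #{(j,k) : j < k, j ∈ S, k ∉ S} − #{(j,k) : j < k, j ∉ S, k ∈ S} ). (This is the exponent l_w in the combinatorial formula |V_{λ+wλ_i}(O) ∩ V_{λ_i}(x_λ)| = q^{l_w} = q_{t_{λ_i}}^{1/2} q̃_{t_{wλ_i}}^{1/2} of Proposition 4.1.) -/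
open Finset

/-- Exchanging the values of `σ` at two consecutive positions where `σ` ascends increases the
number of inversions. -/
theorem card_inversions_lt_mul_swap {n : ℕ} (σ : Equiv.Perm (Fin n)) (a b : Fin n)
    (hab : (b : ℕ) = a + 1) (h : σ a < σ b) :
    (univ.filter (fun p : Fin n × Fin n => p.1 < p.2 ∧ σ p.2 < σ p.1)).card <
      (univ.filter (fun p : Fin n × Fin n => p.1 < p.2 ∧
        (σ * Equiv.swap a b) p.2 < (σ * Equiv.swap a b) p.1)).card := by
  set s := Equiv.swap a b with hs
  rw [← Finset.card_map (Equiv.prodCongr s s).toEmbedding]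
  apply Finset.card_lt_card
  rw [Finset.ssubset_iff_of_subset]
  · refine ⟨(a, b), ?_, ?_⟩
    · simp only [mem_filter, mem_univ, true_and, Equiv.Perm.mul_apply, hs,
        Equiv.swap_apply_left, Equiv.swap_apply_right]
      exact ⟨by rw [Fin.lt_def]; omega, h⟩
    · simp only [mem_map, mem_filter, mem_univ, true_and, not_exists, not_and]
      rintro ⟨p, q⟩ ⟨hpq, -⟩ he
      simp only [Equiv.coe_toEmbedding, Equiv.prodCongr_apply, Prod.map_apply,
        Prod.mk.injEq] at he
      have hp : p = b := by simpa [hs] using congrArg s he.1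
      have hq : q = a := by simpa [hs] using congrArg s he.2
      subst hp hq
      rw [Fin.lt_def] at hpq
      dsimp only at hpq
      omega
  · intro x hx
    simp only [mem_map, mem_filter, mem_univ, true_and] at hx
    obtain ⟨⟨p, q⟩, ⟨hpq, hσ⟩, rfl⟩ := hx
    dsimp only at hpq hσ
    rw [mem_filter]
    simp only [Equiv.coe_toEmbedding, Equiv.prodCongr_apply, Prod.map_apply,
      mem_univ, true_and, Equiv.Perm.mul_apply]
    have hss : ∀ x, s (s x) = x := fun x => by simp [hs]
    rw [hss, hss]
    refine ⟨?_, hσ⟩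
    have hne : ¬ (p = a ∧ q = b) := by
      rintro ⟨rfl, rfl⟩
      exact lt_asymm h hσ
    simp only [hs, Equiv.swap_apply_def]
    simp only [Fin.ext_iff, Fin.lt_def] at *
    split_ifs <;> omega

/-- A permutation with the maximal number of inversions among those mapping the first `i`
positions onto a given set is decreasing on the first `i` positions and on the remaining ones. -/
theorem apply_lt_apply_of_maximal_inversions {n i : ℕ} (σ : Equiv.Perm (Fin n))
    (hmax : ∀ τ : Equiv.Perm (Fin n),
      image τ (univ.filter (fun j : Fin n => (j : ℕ) < i)) =
        image σ (univ.filter (fun j : Fin n => (j : ℕ) < i)) →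
      (univ.filter (fun p : Fin n × Fin n => p.1 < p.2 ∧ τ p.2 < τ p.1)).card ≤
        (univ.filter (fun p : Fin n × Fin n => p.1 < p.2 ∧ σ p.2 < σ p.1)).card)
    {j k : Fin n} (hjk : j < k) (hblock : (j : ℕ) < i ↔ (k : ℕ) < i) : σ k < σ j := by
  have step : ∀ a b : Fin n, (b : ℕ) = a + 1 → ((a : ℕ) < i ↔ (b : ℕ) < i) → σ b < σ a := by
    intro a b hab hb
    by_contra hcon
    have hne : σ a ≠ σ b := fun he => by
      have := congrArg Fin.val (σ.injective he)
      omega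
    have hlt := card_inversions_lt_mul_swap σ a b hab (lt_of_le_of_ne (not_lt.mp hcon) hne)
    refine absurd (hmax (σ * Equiv.swap a b) ?_) (not_le.mpr hlt)
    have hblocks : ∀ x, ((Equiv.swap a b x : Fin n) : ℕ) < i ↔ (x : ℕ) < i := by
      intro x
      rw [Equiv.swap_apply_def]
      split_ifs with h1 h2
      · rw [h1, hb]
      · rw [h2, hb]
      · rfl
    ext y
    simp only [mem_image, mem_filter, mem_univ, true_and, Equiv.Perm.mul_apply]
    constructor
    · rintro ⟨x, hx, rfl⟩
      exact ⟨_, (hblocks x).2 hx, rfl⟩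
    · rintro ⟨x, hx, rfl⟩
      exact ⟨Equiv.swap a b x, (hblocks x).2 hx, by simp⟩
  have main : ∀ d : ℕ, ∀ k : Fin n, (k : ℕ) = j + d + 1 → ((j : ℕ) < i ↔ (k : ℕ) < i) →
      σ k < σ j := by
    intro d
    induction d with
    | zero => exact fun k hk hb => step j k hk hb
    | succ d ih =>
      intro k hk hb
      have hkn := k.isLt
      have h1 := ih ⟨j + d + 1, by omega⟩ rfl (by dsimp only; omega)
      exact (step ⟨j + d + 1, by omega⟩ k (by dsimp only; omega) (by dsimp only; omega)).trans h1
  rw [Fin.lt_def] at hjk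
  exact main (k - j - 1) k (by omega) hblock

/-- The pairs with exactly one entry in `S` are counted by `S` times its complement. -/
theorem card_lt_mem_notMem_add_card_lt_notMem_mem {n : ℕ} (S : Finset (Fin n)) :
    (univ.filter (fun p : Fin n × Fin n => p.1 < p.2 ∧ p.1 ∈ S ∧ p.2 ∉ S)).card +
      (univ.filter (fun p : Fin n × Fin n => p.1 < p.2 ∧ p.1 ∉ S ∧ p.2 ∈ S)).card =
      S.card * (n - S.card) := by
  have hc : (S ×ˢ Sᶜ).card = S.card * (n - S.card) := by
    rw [card_product, card_compl, Fintype.card_fin]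
  rw [← hc, ← card_filter_add_card_filter_not (s := S ×ˢ Sᶜ) (fun p => p.1 < p.2)]
  congr 1
  · congr 1
    ext p
    simp only [mem_filter, mem_univ, true_and, mem_product, mem_compl]
    tauto
  · rw [← Finset.card_map (Equiv.prodComm (Fin n) (Fin n)).toEmbedding]
    congr 1
    ext ⟨p, q⟩
    simp only [mem_filter, mem_univ, true_and, mem_product, mem_compl, mem_map_equiv,
      Equiv.prodComm_symm, Equiv.prodComm_apply, Prod.swap_prod_mk, not_lt]
    constructor
    · rintro ⟨h1, h2, h3⟩
      exact ⟨⟨h3, h2⟩, h1.le⟩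
    · rintro ⟨⟨h1, h2⟩, h3⟩
      exact ⟨lt_of_le_of_ne h3 (fun h => h2 (h ▸ h1)), h2, h1⟩

/-- Let `n ≥ 2`, `1 ≤ i ≤ n-1`, and let `σ` be a permutation of `{1,…,n}` (modelled as
`Fin n`, zero-indexed) having the maximal number of inversions among all permutations `τ`
with `τ({1,…,i}) = σ({1,…,i})`.  Set `S = σ({1,…,i})`.  Then the number of
non-inversions of `σ` satisfies
`#{(j,k) : j<k, σ(j)<σ(k)} = ½( i(n-i) + #{j<k : j∈S, k∉S} - #{j<k : j∉S, k∈S} )`. -/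
theorem noninversion_count_maximal_coset_rep (n i : ℕ) (hn : 2 ≤ n)
    (hi1 : 1 ≤ i) (hi2 : i ≤ n - 1) (σ : Equiv.Perm (Fin n))
    (hmax : ∀ τ : Equiv.Perm (Fin n),
      Finset.image τ (Finset.univ.filter (fun j : Fin n => (j : ℕ) < i)) =
        Finset.image σ (Finset.univ.filter (fun j : Fin n => (j : ℕ) < i)) →
      (Finset.univ.filter (fun p : Fin n × Fin n => p.1 < p.2 ∧ τ p.2 < τ p.1)).card ≤
        (Finset.univ.filter (fun p : Fin n × Fin n => p.1 < p.2 ∧ σ p.2 < σ p.1)).card) :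
    ((Finset.univ.filter
        (fun p : Fin n × Fin n => p.1 < p.2 ∧ σ p.1 < σ p.2)).card : ℝ)
      = ((i : ℝ) * ((n : ℝ) - (i : ℝ))
          + ((Finset.univ.filter (fun p : Fin n × Fin n => p.1 < p.2 ∧
              p.1 ∈ Finset.image σ (Finset.univ.filter (fun j : Fin n => (j : ℕ) < i)) ∧
              p.2 ∉ Finset.image σ (Finset.univ.filter (fun j : Fin n => (j : ℕ) < i)))).card : ℝ)
          - ((Finset.univ.filter (fun p : Fin n × Fin n => p.1 < p.2 ∧
              p.1 ∉ Finset.image σ (Finset.univ.filter (fun j : Fin n => (j : ℕ) < i)) ∧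
              p.2 ∈ Finset.image σ (Finset.univ.filter (fun j : Fin n => (j : ℕ) < i)))).card : ℝ))
        / 2 := by
  set S := Finset.image σ (Finset.univ.filter (fun j : Fin n => (j : ℕ) < i)) with hS
  have hmem : ∀ x, σ x ∈ S ↔ (x : ℕ) < i := by
    intro x
    simp [hS]
  have hScard : S.card = i := by
    rw [hS, card_image_of_injective _ σ.injective, Fin.card_filter_val_lt]
    omega
  have hnoninv : (univ.filter (fun p : Fin n × Fin n => p.1 < p.2 ∧ σ p.1 < σ p.2)).card =
      (univ.filter (fun p : Fin n × Fin n => p.1 < p.2 ∧ p.1 ∈ S ∧ p.2 ∉ S)).card := by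
    rw [← Finset.card_map (Equiv.prodCongr σ σ).toEmbedding]
    congr 1
    ext ⟨a, b⟩
    obtain ⟨p, rfl⟩ := σ.surjective a
    obtain ⟨q, rfl⟩ := σ.surjective b
    simp only [mem_map_equiv, Equiv.prodCongr_symm, Equiv.prodCongr_apply, Prod.map_apply,
      Equiv.symm_apply_apply, mem_filter, mem_univ, true_and, hmem]
    constructor
    · rintro ⟨h1, h2⟩
      have hb : ¬ ((p : ℕ) < i ↔ (q : ℕ) < i) := fun hb =>
        lt_asymm h2 (apply_lt_apply_of_maximal_inversions σ hmax h1 hb)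
      rw [Fin.lt_def] at h1
      exact ⟨h2, by omega, by omega⟩
    · rintro ⟨h1, h2, h3⟩
      exact ⟨by rw [Fin.lt_def]; omega, h1⟩
  have hsum := card_lt_mem_notMem_add_card_lt_notMem_mem S
  rw [hScard] at hsum
  have hsum' := congrArg (Nat.cast (R := ℝ)) hsum
  rw [Nat.cast_add, Nat.cast_mul, Nat.cast_sub (by omega)] at hsum'
  rw [hnoninv, ← hsum']
  ring
end

section
/- For every n ≥ 1 and every x ∈ ℝ^n, the complex-valued integral r(x) := ∫_{ℝ^n} e^{−|θ|²/2} ∏_{1≤j<k≤n} ((x_j − x_k) − i(θ_j − θ_k)) dθ satisfies r(x) = (2π)^{n/2} ∏_{1≤j<k≤n} (x_j − x_k). In particular, r is (up to the explicit constant (2π)^{n/2}) equal to the skew-invariant polynomial π(x) = ∏_{j<k}(x_j − x_k). -/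
open Finset MeasureTheory

/-- If the entries of the `i`-th row of a matrix depend on the `i`-th variable only, then the
integral of the determinant is the determinant of the matrix of integrals. -/
theorem integral_det_of_rows {ι : Type*} [Fintype ι] [DecidableEq ι] (f : ι → ι → ℝ → ℂ)
    (hf : ∀ i j, Integrable (f i j)) :
    ∫ θ : ι → ℝ, (Matrix.of fun i j => f i j (θ i)).det =
      (Matrix.of fun i j => ∫ t, f i j t).det := by
  simp_rw [← Matrix.det_transpose (Matrix.of _), Matrix.det_apply', Matrix.transpose_apply,
    Matrix.of_apply]
  rw [integral_finsetSum]
  · refine Finset.sum_congr rfl fun σ _ => ?_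
    rw [integral_const_mul, integral_fintype_prod_volume_eq_prod fun i t => f i (σ i) t]
  · exact fun σ _ => (Integrable.fintype_prod fun i => hf i (σ i)).const_mul _

/-- The product of the differences over pairs `j < k` is a Vandermonde determinant. -/
theorem prod_pairs_sub_eq_det_vandermonde {R : Type*} [CommRing R] {n : ℕ} (v : Fin n → R) :
    ∏ p ∈ Finset.univ.filter (fun p : Fin n × Fin n => p.1 < p.2), (v p.1 - v p.2) =
      (Matrix.vandermonde fun i => -v i).det := by
  rw [Matrix.det_vandermonde, Finset.prod_filter, ← Finset.univ_product_univ,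
    Finset.prod_product]
  refine Finset.prod_congr rfl fun i _ => ?_
  rw [← Finset.prod_filter, ← Finset.filter_lt_eq_Ioi]
  exact Finset.prod_congr rfl fun j _ => by ring

theorem integrable_pow_mul_gaussian (k : ℕ) :
    Integrable fun t : ℝ => Complex.exp (-(t : ℂ) ^ 2 / 2) * (Complex.I * t) ^ k := by
  have h : Integrable fun t : ℝ => ((t ^ (k : ℝ) * Real.exp (-(1 / 2) * t ^ 2) : ℝ) : ℂ) :=
    (integrable_rpow_mul_exp_neg_mul_sq (by norm_num)
      (by linarith [(Nat.cast_nonneg k : (0 : ℝ) ≤ k)])).ofReal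
  convert h.const_mul (Complex.I ^ k) using 2 with t
  rw [Real.rpow_natCast, mul_pow]
  push_cast
  ring_nf

theorem gaussian_mul_add_pow_eq_sum (y : ℂ) (k : ℕ) (t : ℝ) :
    Complex.exp (-(t : ℂ) ^ 2 / 2) * (y + Complex.I * t) ^ k =
      ∑ m ∈ Finset.range (k + 1), y ^ m * (k.choose m : ℂ) *
        (Complex.exp (-(t : ℂ) ^ 2 / 2) * (Complex.I * t) ^ (k - m)) := by
  rw [add_pow, Finset.mul_sum]
  exact Finset.sum_congr rfl fun m _ => by ring

theorem integrable_gaussian_mul_add_pow (y : ℂ) (k : ℕ) :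
    Integrable fun t : ℝ => Complex.exp (-(t : ℂ) ^ 2 / 2) * (y + Complex.I * t) ^ k := by
  simp_rw [gaussian_mul_add_pow_eq_sum]
  exact integrable_finsetSum _ fun m _ => (integrable_pow_mul_gaussian _).const_mul _

theorem integral_gaussian_half :
    ∫ t : ℝ, Complex.exp (-(t : ℂ) ^ 2 / 2) = (Real.sqrt (2 * Real.pi) : ℂ) := by
  have h := integral_gaussian (1 / 2)
  rw [show Real.pi / (1 / 2) = 2 * Real.pi by ring] at h
  rw [← h, ← integral_complex_ofReal]
  refine integral_congr_ae (.of_forall fun t => ?_)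
  push_cast
  ring_nf

open Polynomial in
/-- The Gaussian average of `(y + i t) ^ k` is a monic polynomial of degree `k` in `y`. -/
theorem exists_monic_integral_gaussian_mul_add_pow (k : ℕ) :
    ∃ p : ℂ[X], p.natDegree = k ∧ p.Monic ∧ ∀ y : ℂ,
      ∫ t : ℝ, Complex.exp (-(t : ℂ) ^ 2 / 2) * (y + Complex.I * t) ^ k =
        (Real.sqrt (2 * Real.pi) : ℂ) * p.eval y := by
  have hc : (Real.sqrt (2 * Real.pi) : ℂ) ≠ 0 := by
    exact_mod_cast (Real.sqrt_pos.2 Real.two_pi_pos).ne'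
  set q : ℂ[X] := ∑ m : Fin k, C ((k.choose m : ℂ) *
    (∫ t : ℝ, Complex.exp (-(t : ℂ) ^ 2 / 2) * (Complex.I * t) ^ (k - m)) /
      (Real.sqrt (2 * Real.pi) : ℂ)) * X ^ (m : ℕ) with hq
  have hdeg : q.degree < k := degree_sum_fin_lt _
  refine ⟨X ^ k + q, ?_, monic_X_pow_add hdeg, fun y => ?_⟩
  · rw [natDegree_add_eq_left_of_degree_lt (by rwa [degree_X_pow]), natDegree_X_pow]
  · simp_rw [gaussian_mul_add_pow_eq_sum]
    rw [integral_finsetSum _ fun m _ => (integrable_pow_mul_gaussian _).const_mul _]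
    simp_rw [integral_const_mul]
    rw [Finset.sum_range_succ, Finset.sum_range, add_comm, eval_add, mul_add, hq,
      eval_finsetSum, Finset.mul_sum]
    congr 1
    · simp [integral_gaussian_half, mul_comm]
    · refine Finset.sum_congr rfl fun m _ => ?_
      simp only [eval_mul, eval_C, eval_pow, eval_X]
      rw [← mul_assoc, mul_div_cancel₀ _ hc]
      ring

/-- For every `n ≥ 1` and every `x ∈ ℝⁿ`, the Gaussian integral
`r(x) := ∫_{ℝⁿ} e^{-|θ|²/2} ∏_{j<k} ((x_j - x_k) - i (θ_j - θ_k)) dθ` equals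
`(2π)^{n/2} ∏_{j<k} (x_j - x_k)`. -/
theorem gaussian_integral_shifted_vandermonde (n : ℕ) (hn : 1 ≤ n) (x : Fin n → ℝ) :
    ∫ θ : Fin n → ℝ,
      Complex.exp (-((∑ j, (θ j) ^ 2 : ℝ) : ℂ) / 2) *
        ∏ p ∈ Finset.univ.filter (fun p : Fin n × Fin n => p.1 < p.2),
          (((x p.1 - x p.2 : ℝ) : ℂ) - Complex.I * ((θ p.1 - θ p.2 : ℝ) : ℂ))
      = (((2 * Real.pi) ^ ((n : ℝ) / 2) : ℝ) : ℂ) *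
          ∏ p ∈ Finset.univ.filter (fun p : Fin n × Fin n => p.1 < p.2),
            ((x p.1 - x p.2 : ℝ) : ℂ) := by
  have hint (θ : Fin n → ℝ) :
      Complex.exp (-((∑ j, (θ j) ^ 2 : ℝ) : ℂ) / 2) *
        ∏ p ∈ Finset.univ.filter (fun p : Fin n × Fin n => p.1 < p.2),
          (((x p.1 - x p.2 : ℝ) : ℂ) - Complex.I * ((θ p.1 - θ p.2 : ℝ) : ℂ)) =
      (Matrix.of fun i j : Fin n =>
        Complex.exp (-(θ i : ℂ) ^ 2 / 2) * (-(x i : ℂ) + Complex.I * θ i) ^ (j : ℕ)).det := by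
    have hexp : Complex.exp (-((∑ j, (θ j) ^ 2 : ℝ) : ℂ) / 2) =
        ∏ j, Complex.exp (-(θ j : ℂ) ^ 2 / 2) := by
      rw [← Complex.exp_sum, ← Finset.sum_div, Finset.sum_neg_distrib]
      push_cast
      rfl
    have hprod := prod_pairs_sub_eq_det_vandermonde fun i => (x i : ℂ) - Complex.I * θ i
    have hv := Matrix.det_mul_column (fun i => Complex.exp (-(θ i : ℂ) ^ 2 / 2))
      (Matrix.vandermonde fun i => -((x i : ℂ) - Complex.I * θ i))
    rw [hexp]
    convert hv.symm using 2
    · rw [← hprod]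
      refine Finset.prod_congr rfl fun p _ => ?_
      push_cast
      ring
    · ext i j
      simp only [Matrix.of_apply, Matrix.vandermonde_apply]
      ring_nf
  simp_rw [hint]
  rw [integral_det_of_rows (fun i j t =>
    Complex.exp (-(t : ℂ) ^ 2 / 2) * (-(x i : ℂ) + Complex.I * t) ^ (j : ℕ))
    fun i j => integrable_gaussian_mul_add_pow _ _]
  choose p hdeg hmonic hp using exists_monic_integral_gaussian_mul_add_pow
  simp_rw [hp]
  have hv := Matrix.det_mul_column (fun _ : Fin n => (Real.sqrt (2 * Real.pi) : ℂ))
    (Matrix.of fun i j : Fin n => (p j).eval (-(x i : ℂ)))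
  simp only [Matrix.of_apply] at hv
  rw [hv, ← Matrix.det_eval_matrixOfPolynomials_eq_det_vandermonde _ (fun j : Fin n => p j)
    (fun j => hdeg j) fun j => hmonic j,
    ← prod_pairs_sub_eq_det_vandermonde fun i => (x i : ℂ)]
  congr 1
  · rw [Finset.prod_const, Finset.card_univ, Fintype.card_fin, Real.sqrt_eq_rpow,
      ← Complex.ofReal_pow, ← Real.rpow_natCast, ← Real.rpow_mul Real.two_pi_pos.le]
    congr 2
    ring
  · simp
end
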